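/- (Lemma 3: upper bound on the service rate of spread allocations under fixed-size access) Let N, m, r, α be positive integers with 2 ≤ α ≤ r ≤ N and mα ≤ N, and let μ > 0 be a real number. Then ∑_{k=α}^{r} (C(mα,k) · C(N−mα, r−k) / C(N,r)) · μ_s(α|k) < μ·m·r/N, where μ_s(α|k) = μ / (H_k − H_{k−α}) and H_k = ∑_{j=1}^k 1/j. -/

import Mathlib

/-- The `k`-th harmonic number `H k = ∑_{j=1}^k 1/j` as a real number. -/
noncomputable def harmonicNumber (n : ℕ) : ℝ := ∑ j ∈ Finset.Icc 1 n, (1 : ℝ) / j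

/-- The conditional service rate `μ_s(α|k) = μ / (H_k − H_{k−α})`. -/
noncomputable def condServiceRate (μ : ℝ) (α k : ℕ) : ℝ :=
  μ / (harmonicNumber k - harmonicNumber (k - α))

/-- The first moment of the hypergeometric weights. -/
theorem sum_mul_choose_mul_choose (a b r : ℕ) :
    ∑ k ∈ Finset.range (r + 2), k * ((a + 1).choose k * b.choose (r + 1 - k))
      = (a + 1) * (a + b).choose r := by
  rw [Finset.sum_range_succ', Nat.add_choose_eq a b r,
    Finset.Nat.sum_antidiagonal_eq_sum_range_succ_mk, Finset.mul_sum]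
  simp only [zero_mul, add_zero]
  refine Finset.sum_congr rfl fun k _ => ?_
  have h := Nat.add_one_mul_choose_eq a k
  rw [Nat.add_sub_add_right, ← mul_assoc, ← mul_assoc, h, mul_comm (k + 1)]

/-- The mean of the hypergeometric distribution, with denominators cleared. -/
theorem mul_sum_mul_choose_mul_choose {N M r : ℕ} (hM : 0 < M) (hr : 0 < r) (hMN : M ≤ N) :
    N * ∑ k ∈ Finset.range (r + 1), k * (M.choose k * (N - M).choose (r - k))
      = M * r * N.choose r := by
  obtain ⟨a, rfl⟩ := Nat.exists_eq_add_of_lt hM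
  obtain ⟨s, rfl⟩ := Nat.exists_eq_add_of_lt hr
  obtain ⟨b, rfl⟩ := Nat.exists_eq_add_of_le hMN
  simp only [zero_add, Nat.add_sub_cancel_left]
  rw [sum_mul_choose_mul_choose, show a + 1 + b = a + b + 1 by ring]
  have h := Nat.add_one_mul_choose_eq (a + b) s
  linear_combination (a + 1) * h

theorem harmonicNumber_sub_eq_sum_Ioc {i k : ℕ} (h : i ≤ k) :
    harmonicNumber k - harmonicNumber i = ∑ j ∈ Finset.Ioc i k, (1 : ℝ) / j := by
  have h0 (n : ℕ) : harmonicNumber n = ∑ j ∈ Finset.Ioc 0 n, (1 : ℝ) / j := rfl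
  rw [h0, h0, ← Finset.sum_Ioc_consecutive _ (Nat.zero_le i) h, add_sub_cancel_left]

/-- A window of at least two reciprocals exceeds its length times its last term. -/
theorem div_lt_harmonicNumber_sub {α k : ℕ} (hα : 2 ≤ α) (hk : α ≤ k) :
    (α : ℝ) / k < harmonicNumber k - harmonicNumber (k - α) := by
  rw [harmonicNumber_sub_eq_sum_Ioc (Nat.sub_le k α)]
  calc (α : ℝ) / k = ∑ _j ∈ Finset.Ioc (k - α) k, (1 : ℝ) / k := by
        rw [Finset.sum_const, Nat.card_Ioc, Nat.sub_sub_self hk, nsmul_eq_mul, mul_one_div]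
    _ < ∑ j ∈ Finset.Ioc (k - α) k, (1 : ℝ) / j := by
        refine Finset.sum_lt_sum (fun j hj => ?_) ⟨k - 1, ?_, ?_⟩
        · rw [Finset.mem_Ioc] at hj
          have hj0 : (0 : ℝ) < j := by exact_mod_cast (by omega : 0 < j)
          exact one_div_le_one_div_of_le hj0 (by exact_mod_cast hj.2)
        · rw [Finset.mem_Ioc]
          omega
        · have h0 : (0 : ℝ) < (k - 1 : ℕ) := by exact_mod_cast (by omega : 0 < k - 1)
          exact one_div_lt_one_div_of_lt h0 (by exact_mod_cast (by omega : k - 1 < k))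

theorem condServiceRate_lt {μ : ℝ} (hμ : 0 < μ) {α k : ℕ} (hα : 2 ≤ α) (hk : α ≤ k) :
    condServiceRate μ α k < μ * k / α := by
  have hα0 : (0 : ℝ) < α := by exact_mod_cast (by omega : 0 < α)
  have hk0 : (0 : ℝ) < k := by exact_mod_cast (by omega : 0 < k)
  calc condServiceRate μ α k < μ / (α / k) :=
        div_lt_div_of_pos_left hμ (div_pos hα0 hk0) (div_lt_harmonicNumber_sub hα hk)
    _ = μ * k / α := by rw [div_div_eq_mul_div]

/-- Lemma 3: in the fixed-size access model, for `2 ≤ α ≤ r`, the average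
service rate of the `(α, mα)` quasi-symmetric allocation is strictly less
than `μ·m·r/N`. -/
theorem spread_allocation_service_rate_lt_fixed (N m r α : ℕ)
    (hN : 0 < N) (hm : 0 < m) (hα : 2 ≤ α) (hαr : α ≤ r) (hrN : r ≤ N)
    (hmαN : m * α ≤ N) (μ : ℝ) (hμ : 0 < μ) :
    ∑ k ∈ Finset.Icc α r,
        ((Nat.choose (m * α) k * Nat.choose (N - m * α) (r - k) : ℕ) : ℝ)
          / ((Nat.choose N r : ℕ) : ℝ) * condServiceRate μ α k
      < μ * m * r / N := by
  have hα0 : (0 : ℝ) < α := by exact_mod_cast (by omega : 0 < α)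
  have hN0 : (0 : ℝ) < N := by exact_mod_cast hN
  have hC : (0 : ℝ) < N.choose r := by exact_mod_cast Nat.choose_pos hrN
  have hαm : α ≤ m * α := Nat.le_mul_of_pos_left α hm
  have hmean := mul_sum_mul_choose_mul_choose (N := N) (M := m * α) (r := r)
    (by omega) (by omega) hmαN
  have hmean' := congrArg (Nat.cast : ℕ → ℝ) hmean
  push_cast at hmean'
  calc _ < ∑ k ∈ Finset.Icc α r,
        (((m * α).choose k * (N - m * α).choose (r - k) : ℕ) : ℝ)
          / (N.choose r : ℝ) * (μ * k / α) := by
        refine Finset.sum_lt_sum (fun k hk => ?_) ⟨min r (m * α), ?_, ?_⟩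
        · exact mul_le_mul_of_nonneg_left
            (condServiceRate_lt hμ hα (Finset.mem_Icc.1 hk).1).le (by positivity)
        · rw [Finset.mem_Icc]
          omega
        · refine mul_lt_mul_of_pos_left (condServiceRate_lt hμ hα (le_min hαr hαm)) ?_
          refine div_pos ?_ hC
          exact_mod_cast Nat.mul_pos (Nat.choose_pos (by omega)) (Nat.choose_pos (by omega))
    _ ≤ ∑ k ∈ Finset.range (r + 1),
        (((m * α).choose k * (N - m * α).choose (r - k) : ℕ) : ℝ)
          / (N.choose r : ℝ) * (μ * k / α) := by
        refine Finset.sum_le_sum_of_subset_of_nonneg (fun k hk => ?_)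
          fun k _ _ => by positivity
        rw [Finset.mem_Icc] at hk
        rw [Finset.mem_range]
        omega
    _ = μ / (α * N.choose r) * ∑ k ∈ Finset.range (r + 1),
        (k : ℝ) * ((m * α).choose k * (N - m * α).choose (r - k)) := by
        rw [Finset.mul_sum]
        refine Finset.sum_congr rfl fun k _ => ?_
        push_cast
        field_simp
    _ = μ * m * r / N := by
        rw [div_mul_eq_mul_div, div_eq_div_iff (by positivity) hN0.ne']
        linear_combination μ * hmean'
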